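/- arXiv:1510.02027 — 5 statements merged into one kernel-verified Lean document; each statement's English description precedes it below -/
import Mathlib

section
/- Let n ≥ 1 and let A and B be symmetric n×n matrices over ℂ. Suppose there exist a nonzero vector v ∈ ℂⁿ and a scalar t₀ ∈ ℂ such that (A + t₀·B) v = 0 (the matrix A + t₀B applied to v is the zero vector) and vᵀ B v = 0. Then the polynomial p(t) = det(A + t·B) ∈ ℂ[t] is divisible by (t − t₀)². -/
open Matrix Polynomial

/-- If every entry of the `k`-th row and of the `k`-th column is divisible by `d`, and the
common diagonal entry is divisible by `d ^ 2`, then the determinant is divisible by `d ^ 2`. -/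
theorem Matrix.sq_dvd_det_of_dvd_row_of_dvd_col {m R : Type*} [Fintype m] [DecidableEq m]
    [CommRing R] (N : Matrix m m R) (k : m) (d : R) (hrow : ∀ j, d ∣ N k j)
    (hcol : ∀ i, d ∣ N i k) (hdiag : d ^ 2 ∣ N k k) : d ^ 2 ∣ N.det := by
  rw [det_apply]
  refine Finset.dvd_sum fun σ _ => dvd_smul_of_dvd _ ?_
  rw [← Finset.mul_prod_erase _ _ (Finset.mem_univ k)]
  by_cases h : σ k = k
  · exact (by simpa [h] using hdiag : d ^ 2 ∣ N (σ k) k).mul_right _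
  · have hmem : σ.symm k ∈ Finset.univ.erase k := by
      simpa [Equiv.symm_apply_eq] using Ne.symm h
    rw [sq]
    refine mul_dvd_mul (hcol _) (dvd_trans ?_ (Finset.dvd_prod_of_mem _ hmem))
    simpa using hrow (σ.symm k)

/-- A null vector `v` of both `S` and its transpose with `vᵀ B v = 0` forces
`det (S + d B)`, multiplied by the square of any coordinate of `v`, to be divisible by `d ^ 2`. -/
theorem Matrix.sq_dvd_sq_mul_det_add_smul {m R : Type*} [Fintype m] [DecidableEq m]
    [CommRing R] (S B : Matrix m m R) (v : m → R) (d : R) (hr : S *ᵥ v = 0) (hl : v ᵥ* S = 0)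
    (hB : v ⬝ᵥ B *ᵥ v = 0) (k : m) : d ^ 2 ∣ v k ^ 2 * (S + d • B).det := by
  set P : Matrix m m R := (1 : Matrix m m R).updateCol k v with hP
  have hdet : P.det = v k := by rw [hP, ← cramer_apply, cramer_one]; rfl
  have hPk : P.col k = v := by ext i; simp [hP]
  have hN (i j : m) : (Pᵀ * (S + d • B) * P) i j = P.col i ⬝ᵥ (S + d • B) *ᵥ P.col j := by
    rw [Matrix.mul_assoc]
    rfl
  have hMr : (S + d • B) *ᵥ v = d • B *ᵥ v := by rw [add_mulVec, hr, zero_add, smul_mulVec]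
  have hMl : v ᵥ* (S + d • B) = d • v ᵥ* B := by rw [vecMul_add, hl, zero_add, vecMul_smul]
  have key := sq_dvd_det_of_dvd_row_of_dvd_col (Pᵀ * (S + d • B) * P) k d
    (fun j => by
      rw [hN, hPk, dotProduct_mulVec, hMl, smul_dotProduct]
      exact dvd_mul_right _ _)
    (fun i => by
      rw [hN, hPk, hMr, dotProduct_smul]
      exact dvd_mul_right _ _)
    (by rw [hN, hPk, hMr, dotProduct_smul, hB, smul_zero]; exact dvd_zero _)
  rw [det_mul, det_mul, det_transpose, hdet] at key
  convert key using 1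
  ring

/-- If a pencil of symmetric quadrics `A + t B` has a singular point `v` of the quadric
`A + t₀ B` which also satisfies `vᵀ B v = 0`, then `t₀` is a root of multiplicity at least
two of `det (A + t B)`. -/
theorem det_pencil_double_root (n : ℕ) (hn : 1 ≤ n)
    (A B : Matrix (Fin n) (Fin n) ℂ) (hA : A.IsSymm) (hB : B.IsSymm)
    (v : Fin n → ℂ) (hv : v ≠ 0) (t₀ : ℂ)
    (h1 : (A + t₀ • B).mulVec v = 0)
    (h2 : v ⬝ᵥ B.mulVec v = 0) :
    (Polynomial.X - Polynomial.C t₀) ^ 2 ∣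
      (Matrix.of fun i j => Polynomial.C (A i j) + Polynomial.X * Polynomial.C (B i j)).det := by
  obtain ⟨k, hk⟩ := Function.ne_iff.mp hv
  have hl : v ᵥ* (A + t₀ • B) = 0 := by
    rw [← mulVec_transpose, (hA.add (hB.smul t₀)).eq, h1]
  have hpencil : (Matrix.of fun i j => C (A i j) + X * C (B i j)) =
      (A + t₀ • B).map C + (X - C t₀) • B.map C := by
    ext1 i j
    simp only [of_apply, Matrix.add_apply, Matrix.map_apply, Matrix.smul_apply, smul_eq_mul, map_add, map_mul]
    ring
  have hdvd := sq_dvd_sq_mul_det_add_smul ((A + t₀ • B).map C) (B.map C) (C ∘ v) (X - C t₀)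
    (by ext1 i; rw [← RingHom.map_mulVec, h1]; simp)
    (by ext1 i; rw [← RingHom.map_vecMul, hl]; simp)
    (by
      have hBv : B.map C *ᵥ (C ∘ v) = C ∘ (B *ᵥ v) := by
        ext1 i
        rw [← RingHom.map_mulVec, Function.comp_apply]
      rw [hBv, ← RingHom.map_dotProduct, h2, map_zero]) k
  rw [hpencil]
  exact ((isUnit_C.mpr (isUnit_iff_ne_zero.mpr hk)).pow 2).dvd_mul_left.mp hdvd
end

section
/- Let K be a field, n ≥ 1, and let M be a symmetric n×n matrix over K. If there exists a nonzero vector v ∈ Kⁿ with M v = 0, then the adjugate matrix of M is a scalar multiple of the rank-one matrix v vᵀ; that is, there exists c ∈ K such that adjugate(M) = c · (v vᵀ), where (v vᵀ)ᵢⱼ = vᵢ vⱼ. -/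
open Matrix

/-- If `M` kills a nonzero vector `v`, then every row vector orthogonal to `v` is killed by the
adjugate of `M`. -/
lemma Matrix.vecMul_adjugate_eq_zero_of_dotProduct_eq_zero {ι R : Type*} [Fintype ι]
    [DecidableEq ι] [CommRing R] [IsDomain R] {M : Matrix ι ι R} {v w : ι → R} (hv : v ≠ 0)
    (h : M *ᵥ v = 0) (hw : w ⬝ᵥ v = 0) : w ᵥ* M.adjugate = 0 := by
  ext k
  rw [← mulVec_transpose, adjugate_transpose, ← cramer_eq_adjugate_mulVec,
    cramer_transpose_apply, Pi.zero_apply, ← exists_mulVec_eq_zero_iff]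
  refine ⟨v, hv, ?_⟩
  ext l
  obtain rfl | hl := eq_or_ne l k
  · simpa [mulVec] using hw
  · simpa [mulVec, updateRow_ne hl] using congrFun h l

/-- If `M` kills a nonzero vector `v`, then every column of the adjugate of `M` is proportional
to `v`. -/
lemma Matrix.mul_adjugate_apply_comm_of_mulVec_eq_zero {ι R : Type*} [Fintype ι]
    [DecidableEq ι] [CommRing R] [IsDomain R] {M : Matrix ι ι R} {v : ι → R} (hv : v ≠ 0)
    (h : M *ᵥ v = 0) (i j k : ι) : v i * M.adjugate j k = v j * M.adjugate i k := by
  have hw : (v i • Pi.single j 1 - v j • Pi.single i 1 : ι → R) ⬝ᵥ v = 0 := by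
    simp [sub_dotProduct, mul_comm]
  have := congrFun (vecMul_adjugate_eq_zero_of_dotProduct_eq_zero hv h hw) k
  simpa [sub_vecMul, smul_vecMul, sub_eq_zero] using this

/-- If a symmetric matrix `M` over a field kills a nonzero vector `v`, then its adjugate
is a scalar multiple of the rank-one matrix `v vᵀ`. -/
theorem adjugate_eq_smul_vecMulVec (K : Type*) [Field K] (n : ℕ) (hn : 1 ≤ n)
    (M : Matrix (Fin n) (Fin n) K) (hM : M.IsSymm)
    (v : Fin n → K) (hv : v ≠ 0) (h : M.mulVec v = 0) :
    ∃ c : K, M.adjugate = c • Matrix.vecMulVec v v := by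
  obtain ⟨i, hi⟩ := Function.ne_iff.mp hv
  rw [Pi.zero_apply] at hi
  refine ⟨M.adjugate i i / v i ^ 2, ?_⟩
  ext j k
  have hjk := mul_adjugate_apply_comm_of_mulVec_eq_zero hv h i j k
  have hki := mul_adjugate_apply_comm_of_mulVec_eq_zero hv h i k i
  rw [hM.adjugate.apply i k] at hki
  rw [Matrix.smul_apply, vecMulVec_apply, smul_eq_mul]
  field_simp
  linear_combination v i * hjk + v j * hki
end

section
/- Let F = x₀²x₂ + x₁²x₃ ∈ ℂ[x₀,x₁,x₂,x₃]. For every nonzero vector (a,b,c,d) ∈ ℂ⁴ with a²c + b²d = 0, there exist vectors (s,t) ∈ ℂ² \ {0} and (y,z) ∈ ℂ² \ {0} with s²y + t²z = 0, and scalars α, β ∈ ℂ, such that (a,b,c,d) = (αs, αt, βy, βz). Consequently every point of the surface V = {F = 0} ⊂ ℙ³ lies on a line contained in V which meets both the line r = {x₂ = x₃ = 0} and the line s = {x₀ = x₁ = 0} (the line joining (s:t:0:0) ∈ r and (0:0:y:z) ∈ s, which lies in V because F(αs, αt, βy, βz) = α²β(s²y + t²z) = 0 for all α, β). -/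
/-- Every point of the cubic surface `{x₀²x₂ + x₁²x₃ = 0} ⊂ ℙ³` lies on a line contained
in the surface joining a point of `r = {x₂ = x₃ = 0}` with a point of `s = {x₀ = x₁ = 0}`:
explicitly, every nonzero `(a,b,c,d)` with `a²c + b²d = 0` decomposes as
`(αs, αt, βy, βz)` with `(s,t) ≠ 0`, `(y,z) ≠ 0` and `s²y + t²z = 0`. -/
theorem genProjCubic_ruled (a b c d : ℂ) (h0 : (a, b, c, d) ≠ (0, 0, 0, 0))
    (h : a ^ 2 * c + b ^ 2 * d = 0) :
    ∃ s t y z α β : ℂ, (s, t) ≠ (0, 0) ∧ (y, z) ≠ (0, 0) ∧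
      s ^ 2 * y + t ^ 2 * z = 0 ∧
      a = α * s ∧ b = α * t ∧ c = β * y ∧ d = β * z := by
  by_cases hab : (a, b) = (0, 0)
  · obtain ⟨rfl, rfl⟩ := Prod.mk.inj hab
    obtain ⟨s, hs⟩ := IsAlgClosed.exists_eq_mul_self d
    obtain ⟨t, ht⟩ := IsAlgClosed.exists_eq_mul_self (-c)
    have hcd : (c, d) ≠ (0, 0) := fun hcd => h0 (by simp_all)
    refine ⟨s, t, c, d, 0, 1, fun hst => hcd ?_, hcd, ?_, by simp, by simp, by simp, by simp⟩
    · obtain ⟨rfl, rfl⟩ := Prod.mk.inj hst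
      simp_all
    · linear_combination -c * hs - d * ht
  · by_cases hcd : (c, d) = (0, 0)
    · obtain ⟨rfl, rfl⟩ := Prod.mk.inj hcd
      refine ⟨a, b, b ^ 2, -a ^ 2, 1, 0, hab, fun hba => hab ?_, by ring,
        by simp, by simp, by simp, by simp⟩
      simp_all
    · exact ⟨a, b, c, d, 1, 1, hab, hcd, h, by simp, by simp, by simp, by simp⟩
end

section
/- Consider the map φ : ℂ³ → ℂ⁴ given by φ(u₀,u₁,u₂) = (u₀²−u₁²+u₂², u₂²−u₁², u₁u₂, u₀u₁). If u = (u₀,u₁,u₂) ∈ ℂ³ is nonzero and φ(u) = λ·(1,1,0,0) for some λ ∈ ℂ, then u is a scalar multiple of (0,1,0) or of (0,0,1). Hence the triple point p = (1:1:0:0) of the type (ii) quartic surface has exactly two preimages in ℙ², namely (0:1:0) and (0:0:1). -/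
/-- The triple point `p = (1:1:0:0)` of the type (ii) quartic has exactly two preimages
in `ℙ²` under `(u₀:u₁:u₂) ↦ (u₀²−u₁²+u₂² : u₂²−u₁² : u₁u₂ : u₀u₁)`,
namely `(0:1:0)` and `(0:0:1)`. -/
theorem quarticII_triple_point_preimages (u₀ u₁ u₂ lam : ℂ)
    (hu : (u₀, u₁, u₂) ≠ (0, 0, 0))
    (h0 : u₀ ^ 2 - u₁ ^ 2 + u₂ ^ 2 = lam)
    (h1 : u₂ ^ 2 - u₁ ^ 2 = lam)
    (h2 : u₁ * u₂ = 0)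
    (h3 : u₀ * u₁ = 0) :
    (∃ μ : ℂ, (u₀, u₁, u₂) = (0, μ, 0)) ∨ (∃ μ : ℂ, (u₀, u₁, u₂) = (0, 0, μ)) := by
  have hu₀ : u₀ = 0 := pow_eq_zero_iff two_ne_zero |>.mp (by linear_combination h0 - h1)
  rcases mul_eq_zero.mp h2 with hu₁ | hu₂
  · exact Or.inr ⟨u₂, by rw [hu₀, hu₁]⟩
  · exact Or.inl ⟨u₁, by rw [hu₀, hu₂]⟩
end

section
/- Consider the map ψ : ℂ³ → ℂ⁴ given by ψ(u₀,u₁,u₂) = (u₀²+2u₁²+u₂², 2u₁²+u₂², u₂²+2u₀u₂, u₁u₂+u₀u₁). If u = (u₀,u₁,u₂) ∈ ℂ³ is nonzero and ψ(u) = λ·(2,1,−1,0) for some λ ∈ ℂ, then u is a scalar multiple of (1,0,−1). Hence the triple point p = (2:1:−1:0) of the type (iii) quartic surface has exactly one preimage in ℙ², namely (1:0:−1). -/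
/-- The triple point `p = (2:1:−1:0)` of the type (iii) quartic has exactly one preimage
in `ℙ²` under `(u₀:u₁:u₂) ↦ (u₀²+2u₁²+u₂² : 2u₁²+u₂² : u₂²+2u₀u₂ : u₁u₂+u₀u₁)`,
namely `(1:0:−1)`. -/
theorem quarticIII_triple_point_preimage (u₀ u₁ u₂ lam : ℂ)
    (hu : (u₀, u₁, u₂) ≠ (0, 0, 0))
    (h0 : u₀ ^ 2 + 2 * u₁ ^ 2 + u₂ ^ 2 = lam * 2)
    (h1 : 2 * u₁ ^ 2 + u₂ ^ 2 = lam * 1)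
    (h2 : u₂ ^ 2 + 2 * u₀ * u₂ = lam * (-1))
    (h3 : u₁ * u₂ + u₀ * u₁ = lam * 0) :
    ∃ μ : ℂ, (u₀, u₁, u₂) = (μ, 0, -μ) := by
  have hsum : u₀ + u₂ = 0 := pow_eq_zero_iff two_ne_zero |>.mp
    (by linear_combination h0 - h1 + h2 : (u₀ + u₂) ^ 2 = 0)
  have hu₁ : u₁ = 0 := pow_eq_zero_iff two_ne_zero |>.mp
    (by linear_combination h1 - h0 / 2 + (u₀ - u₂) / 2 * hsum : u₁ ^ 2 = 0)
  exact ⟨u₀, by rw [hu₁, eq_neg_of_add_eq_zero_right hsum]⟩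
end
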